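/- arXiv:2111.10849 — 2 statements merged into one kernel-verified Lean document; each statement's English description precedes it below -/
import Mathlib

section
/- Let σ ∈ M^0_{ρ,Λ} and 1 < p < ∞. Fix τ with 0 < τ < ρμ₀/(1 + ρμ₀). Let (x_k) and (ξ_k) be sequences in ℝⁿ with |ξ_k| → ∞ and σ(x_k, ξ_k) → σ_∞ ∈ ℂ as k → ∞, and set λ_k = |ξ_k| and σ_{λ_k,τ}(x,η) = σ(x_k + λ_k^{−τ}x, ξ_k + λ_k^τ η). Then for every u ∈ 𝒮(ℝⁿ), the functions T_{σ_{λ_k,τ}} u converge to σ_∞ u in L^p(ℝⁿ) as k → ∞. -/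
open MeasureTheory Real Filter
open scoped RealInnerProductSpace BigOperators ENNReal

noncomputable section

/-- Euclidean space ℝⁿ. -/
abbrev En (n : ℕ) : Type := EuclideanSpace ℝ (Fin n)

/-- Partial derivative in the `i`-th coordinate direction. -/
def pd {n : ℕ} {F : Type*} [NormedAddCommGroup F] [NormedSpace ℝ F]
    (i : Fin n) (f : En n → F) : En n → F :=
  fun x => fderiv ℝ f x (EuclideanSpace.single i 1)

/-- Iterated partial derivative `∂^α` for a multi-index `α`. -/
def mpd {n : ℕ} {F : Type*} [NormedAddCommGroup F] [NormedSpace ℝ F]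
    (α : Fin n → ℕ) (f : En n → F) : En n → F :=
  (List.finRange n).foldr (fun i g => (pd i)^[α i] g) f

/-- Mixed derivative `∂_x^α ∂_ξ^β σ` of a symbol. -/
def mixpd {n : ℕ} (α β : Fin n → ℕ) (σ : En n → En n → ℂ) : En n → En n → ℂ :=
  fun x ξ => mpd α (fun y => mpd β (σ y) ξ) x

/-- `Λ` is a weight function of polynomial growth with parameters `μ₀ ≤ μ₁ ≤ μ`. -/
structure IsWeight (n : ℕ) (Λ : En n → ℝ) (μ₀ μ₁ μ : ℝ) : Prop where
  pos : ∀ ξ, 0 < Λ ξ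
  smooth : ContDiff ℝ (⊤ : ℕ∞) Λ
  growth : ∃ C₀ C₁ : ℝ, 0 < C₀ ∧ C₀ ≤ C₁ ∧ ∀ ξ : En n,
    C₀ * (1 + ‖ξ‖) ^ μ₀ ≤ Λ ξ ∧ Λ ξ ≤ C₁ * (1 + ‖ξ‖) ^ μ₁
  hμ₀ : 0 < μ₀
  hμ₀₁ : μ₀ ≤ μ₁
  hμ₁ : μ₁ ≤ μ
  deriv_bound : ∀ (α γ : Fin n → ℕ), (∀ i, γ i ≤ 1) →
    ∃ C > 0, ∀ ξ : En n,
      |(∏ i, ξ i ^ γ i) * mpd (α + γ) Λ ξ| ≤ C * Λ ξ ^ (1 - (∑ i, (α i : ℝ)) / μ)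

/-- The symbol class `S^m_{ρ,Λ}`. -/
def SClass {n : ℕ} (Λ : En n → ℝ) (ρ m : ℝ) (σ : En n → En n → ℂ) : Prop :=
  ContDiff ℝ (⊤ : ℕ∞) (fun q : En n × En n => σ q.1 q.2) ∧
  ∀ α β : Fin n → ℕ, ∃ C > 0, ∀ x ξ : En n,
    ‖mixpd α β σ x ξ‖ ≤ C * Λ ξ ^ (m - ρ * ∑ i, (β i : ℝ))

/-- The symbol class `M^m_{ρ,Λ}`. -/
def MClass {n : ℕ} (Λ : En n → ℝ) (ρ m : ℝ) (σ : En n → En n → ℂ) : Prop :=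
  ∀ γ : Fin n → ℕ, (∀ i, γ i ≤ 1) →
    SClass Λ ρ m (fun x ξ => ((∏ i, ξ i ^ γ i : ℝ) : ℂ) * mixpd 0 γ σ x ξ)

/-- The Fourier transform `φ̂(ξ) = (2π)^{-n/2} ∫ e^{-ix·ξ} φ(x) dx`. -/
def ft {n : ℕ} (φ : En n → ℂ) (ξ : En n) : ℂ :=
  (((2 * Real.pi) ^ (-(n : ℝ) / 2) : ℝ) : ℂ) *
    ∫ (x : En n), Complex.exp (-Complex.I * (⟪x, ξ⟫ : ℂ)) * φ x

/-- The pseudo-differential operator `T_σ`. -/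
def pdo {n : ℕ} (σ : En n → En n → ℂ) (φ : En n → ℂ) (x : En n) : ℂ :=
  (((2 * Real.pi) ^ (-(n : ℝ) / 2) : ℝ) : ℂ) *
    ∫ (ξ : En n), Complex.exp (Complex.I * (⟪x, ξ⟫ : ℂ)) * σ x ξ * ft φ ξ

end

noncomputable section

/-- The SG symbol class `S^{m₁,m₂}_{ρ,Λ}`. -/
def SGClass {n : ℕ} (Λ : En n → ℝ) (ρ m₁ m₂ : ℝ) (σ : En n → En n → ℂ) : Prop :=
  ContDiff ℝ (⊤ : ℕ∞) (fun q : En n × En n => σ q.1 q.2) ∧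
  ∀ α β : Fin n → ℕ, ∃ C > 0, ∀ x ξ : En n,
    ‖mixpd α β σ x ξ‖ ≤
      C * Λ x ^ (m₂ - ρ * ∑ i, (α i : ℝ)) * Λ ξ ^ (m₁ - ρ * ∑ i, (β i : ℝ))

/-- The SG symbol class `M^{m₁,m₂}_{ρ,Λ}`. -/
def SGMClass {n : ℕ} (Λ : En n → ℝ) (ρ m₁ m₂ : ℝ) (σ : En n → En n → ℂ) : Prop :=
  ∀ γ δ : Fin n → ℕ, (∀ i, γ i ≤ 1) → (∀ i, δ i ≤ 1) →
    SGClass Λ ρ m₁ m₂ (fun x ξ =>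
      ((∏ i, x i ^ δ i : ℝ) : ℂ) * ((∏ i, ξ i ^ γ i : ℝ) : ℂ) * mixpd δ γ σ x ξ)

end
open scoped ContDiff SchwartzMap FourierTransform LineDeriv

section PartialDerivatives

variable {n : ℕ} {F : Type*} [NormedAddCommGroup F] [NormedSpace ℝ F]

lemma mpd_zero (f : En n → F) : mpd 0 f = f := by
  simp [mpd]

lemma mpd_single (i : Fin n) (j : ℕ) (f : En n → F) :
    mpd (Pi.single i j) f = (pd i)^[j] f := by
  unfold mpd
  have key : ∀ l : List (Fin n), l.Nodup →
      l.foldr (fun a g => (pd a)^[(Pi.single i j : Fin n → ℕ) a] g) f =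
        if i ∈ l then (pd i)^[j] f else f := by
    intro l
    induction l with
    | nil => simp
    | cons a l ih =>
      intro hl
      rw [List.nodup_cons] at hl
      rw [List.foldr_cons, ih hl.2]
      by_cases h : a = i
      · subst h
        simp [hl.1]
      · simp [h, Ne.symm h]
  simpa using key _ (List.nodup_finRange n)

lemma contDiff_pd (i : Fin n) {f : En n → F} (hf : ContDiff ℝ ∞ f) : ContDiff ℝ ∞ (pd i f) :=
  (hf.fderiv_right (by simp)).clm_apply contDiff_const

lemma pd_comp_affine (i : Fin n) (f : En n → F) (a : En n) (c : ℝ) :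
    pd i (fun η => f (a + c • η)) = fun η => c • pd i f (a + c • η) := by
  funext η
  have h := fderiv_comp_smul (𝕜 := ℝ) (f := fun ζ => f (a + ζ)) (x := η) c
  simp only [fderiv_comp_add_left] at h
  simp [pd, h]

lemma pd_const_smul (i : Fin n) (f : En n → F) (c : ℝ) :
    pd i (fun η => c • f η) = fun η => c • pd i f η := by
  funext η
  change fderiv ℝ (c • f) η _ = _
  simp [fderiv_const_smul_field, pd]

lemma iterate_pd_comp_affine (i : Fin n) (a : En n) (c : ℝ) (j : ℕ) (f : En n → F) :
    (pd i)^[j] (fun η => f (a + c • η)) = fun η => c ^ j • (pd i)^[j] f (a + c • η) := by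
  induction j with
  | zero => simp
  | succ j ih =>
    rw [Function.iterate_succ_apply', ih, pd_const_smul, pd_comp_affine]
    funext η
    simp [Function.iterate_succ_apply', smul_smul, pow_succ]

lemma eq_sum_smul_single (v : En n) : v = ∑ i, v i • EuclideanSpace.single i (1 : ℝ) := by
  simpa using ((EuclideanSpace.basisFun (Fin n) ℝ).sum_repr v).symm

lemma norm_le_sum_abs (v : En n) : ‖v‖ ≤ ∑ i, |v i| := by
  conv_lhs => rw [eq_sum_smul_single v]
  refine (norm_sum_le _ _).trans (Finset.sum_le_sum fun i _ => ?_)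
  simp [norm_smul]

lemma norm_clm_le_sum_basis (L : En n →L[ℝ] F) :
    ‖L‖ ≤ ∑ i, ‖L (EuclideanSpace.single i 1)‖ := by
  refine L.opNorm_le_bound (by positivity) fun v => ?_
  conv_lhs => rw [eq_sum_smul_single v]
  rw [map_sum, Finset.sum_mul]
  refine (norm_sum_le _ _).trans (Finset.sum_le_sum fun i _ => ?_)
  rw [map_smul, norm_smul, mul_comm]
  gcongr
  exact PiLp.norm_apply_le v i

end PartialDerivatives

section OscillatoryIntegrals

variable {n : ℕ}

lemma norm_exp_I_inner (x η : En n) : ‖Complex.exp (Complex.I * (⟪x, η⟫ : ℂ))‖ = 1 := by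
  rw [mul_comm]
  exact Complex.norm_exp_ofReal_mul_I _

lemma differentiable_exp_I_inner (x : En n) :
    Differentiable ℝ (fun η : En n => Complex.exp (Complex.I * (⟪x, η⟫ : ℂ))) := by
  have h : Differentiable ℝ (fun η : En n => (⟪x, η⟫ : ℂ)) :=
    Complex.ofRealCLM.differentiable.comp (innerSL ℝ x).differentiable
  exact (h.const_mul _).cexp

lemma pd_exp_I_inner (i : Fin n) (x η : En n) :
    pd i (fun η : En n => Complex.exp (Complex.I * (⟪x, η⟫ : ℂ))) η =
      Complex.I * x i * Complex.exp (Complex.I * (⟪x, η⟫ : ℂ)) := by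
  have h : HasFDerivAt (fun η : En n => (⟪x, η⟫ : ℂ))
      (Complex.ofRealCLM.comp (innerSL ℝ x)) η :=
    (Complex.ofRealCLM.comp (innerSL ℝ x)).hasFDerivAt
  simp only [pd]
  rw [(h.const_mul Complex.I).cexp.fderiv]
  simp [EuclideanSpace.inner_single_right]
  ring

lemma integrable_one_add_norm_pow_mul (w : 𝓢(En n, ℂ)) (M : ℕ) :
    Integrable (fun η : En n => (1 + ‖η‖) ^ M * ‖w η‖) := by
  have h : ∀ η : En n, (1 + ‖η‖) ^ M * ‖w η‖ =
      ∑ m ∈ Finset.range (M + 1), (M.choose m : ℝ) * (‖η‖ ^ m * ‖w η‖) := fun η => by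
    rw [add_comm, add_pow, Finset.sum_mul]
    exact Finset.sum_congr rfl fun m _ => by simp; ring
  simp_rw [h]
  exact integrable_finsetSum _ fun m _ => (w.integrable_pow_mul volume m).const_mul _

lemma integrable_exp_mul_mul {g : En n → ℂ} (hg : Continuous g) {C : ℝ} {M : ℕ}
    (hb : ∀ η, ‖g η‖ ≤ C * (1 + ‖η‖) ^ M) (w : 𝓢(En n, ℂ)) (x : En n) :
    Integrable (fun η : En n => Complex.exp (Complex.I * (⟪x, η⟫ : ℂ)) * (g η * w η)) := by
  refine ((integrable_one_add_norm_pow_mul w M).const_mul C).mono'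
    ((differentiable_exp_I_inner x).continuous.mul
      (hg.mul w.continuous)).aestronglyMeasurable (ae_of_all _ fun η => ?_)
  rw [norm_mul, norm_exp_I_inner, one_mul, norm_mul, ← mul_assoc]
  gcongr
  exact hb η

/-- Integration by parts in an oscillatory integral, in the `i`-th coordinate direction. -/
lemma coord_mul_integral_exp_mul (i : Fin n) {g : En n → ℂ} (hg : ContDiff ℝ ∞ g)
    {C C' : ℝ} {M M' : ℕ} (hb : ∀ η, ‖g η‖ ≤ C * (1 + ‖η‖) ^ M)
    (hb' : ∀ η, ‖pd i g η‖ ≤ C' * (1 + ‖η‖) ^ M') (w : 𝓢(En n, ℂ)) (x : En n) :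
    (x i : ℂ) * ∫ η, Complex.exp (Complex.I * (⟪x, η⟫ : ℂ)) * (g η * w η) =
      Complex.I * ((∫ η, Complex.exp (Complex.I * (⟪x, η⟫ : ℂ)) * (pd i g η * w η)) +
        ∫ η, Complex.exp (Complex.I * (⟪x, η⟫ : ℂ)) *
          (g η * (∂_{EuclideanSpace.single i (1 : ℝ)} w) η)) := by
  have i0 := integrable_exp_mul_mul hg.continuous hb w x
  have i1 := integrable_exp_mul_mul (contDiff_pd i hg).continuous hb' w x
  have i2 := integrable_exp_mul_mul hg.continuous hb (∂_{EuclideanSpace.single i (1 : ℝ)} w) x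
  have hgd : Differentiable ℝ g := hg.differentiable (by simp)
  have hprod : ∀ η, fderiv ℝ (fun η => g η * w η) η (EuclideanSpace.single i 1) =
      pd i g η * w η + g η * (∂_{EuclideanSpace.single i (1 : ℝ)} w) η := fun η => by
    rw [fderiv_fun_mul (hgd η) w.differentiableAt, SchwartzMap.lineDerivOp_apply_eq_fderiv]
    simp [pd]
    ring
  have hexp : ∀ η, fderiv ℝ (fun η : En n => Complex.exp (Complex.I * (⟪x, η⟫ : ℂ))) η
      (EuclideanSpace.single i 1) =
        Complex.I * x i * Complex.exp (Complex.I * (⟪x, η⟫ : ℂ)) := pd_exp_I_inner i x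
  have parts := integral_mul_fderiv_eq_neg_fderiv_mul_of_integrable (μ := volume)
    (f := fun η : En n => Complex.exp (Complex.I * (⟪x, η⟫ : ℂ))) (g := fun η => g η * w η)
    (v := EuclideanSpace.single i 1)
    (by simp_rw [hexp, mul_assoc]; simpa [mul_assoc] using (i0.const_mul (Complex.I * x i)))
    (by simp_rw [hprod, mul_add]; exact i1.add i2) i0
    (fun η _ => differentiable_exp_I_inner x η)
    (fun η _ => (hgd η).mul w.differentiableAt)
  simp_rw [hprod, hexp, mul_add] at parts
  rw [integral_add i1 i2] at parts
  rw [parts]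
  simp_rw [mul_assoc, integral_const_mul]
  linear_combination
    ((x i : ℂ) * ∫ η, Complex.exp (Complex.I * (⟪x, η⟫ : ℂ)) * (g η * w η)) * Complex.I_mul_I

/-- Oscillatory integrals with smooth amplitudes of polynomial growth decay rapidly in each
coordinate, uniformly in the amplitude. -/
lemma exists_abs_coord_pow_mul_norm_integral_le (i : Fin n) (N : ℕ) :
    ∀ (w : 𝓢(En n, ℂ)) (C : ℕ → ℝ) (M : ℕ → ℕ), ∃ K : ℝ, ∀ g : En n → ℂ, ContDiff ℝ ∞ g →
      (∀ j η, ‖(pd i)^[j] g η‖ ≤ C j * (1 + ‖η‖) ^ M j) → ∀ x : En n,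
        |x i| ^ N * ‖∫ η, Complex.exp (Complex.I * (⟪x, η⟫ : ℂ)) * (g η * w η)‖ ≤ K := by
  induction N with
  | zero =>
    intro w C M
    refine ⟨∫ η, C 0 * ((1 + ‖η‖) ^ M 0 * ‖w η‖), fun g _ hb x => ?_⟩
    rw [pow_zero, one_mul]
    refine norm_integral_le_of_norm_le ((integrable_one_add_norm_pow_mul w (M 0)).const_mul _)
      (ae_of_all _ fun η => ?_)
    rw [norm_mul, norm_exp_I_inner, one_mul, norm_mul, ← mul_assoc]
    gcongr
    exact hb 0 η
  | succ N ih =>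
    intro w C M
    obtain ⟨K₁, h₁⟩ := ih w (fun j => C (j + 1)) (fun j => M (j + 1))
    obtain ⟨K₂, h₂⟩ := ih (∂_{EuclideanSpace.single i (1 : ℝ)} w) C M
    refine ⟨K₁ + K₂, fun g hg hb x => ?_⟩
    have e := congrArg norm (coord_mul_integral_exp_mul i hg (hb 0) (hb 1) w x)
    rw [norm_mul, norm_mul, Complex.norm_I, one_mul, Complex.norm_real, Real.norm_eq_abs] at e
    rw [pow_succ, mul_assoc, e]
    calc _ ≤ _ := mul_le_mul_of_nonneg_left (norm_add_le _ _) (by positivity)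
      _ ≤ _ := by
        rw [mul_add]
        exact add_le_add (h₁ _ (contDiff_pd i hg) (fun j η => hb (j + 1) η) x) (h₂ g hg hb x)

lemma exists_norm_integral_le_one_add_norm (N : ℕ) (w : 𝓢(En n, ℂ)) (C : ℕ → ℝ) (M : ℕ → ℕ) :
    ∃ K : ℝ, ∀ g : En n → ℂ, ContDiff ℝ ∞ g →
      (∀ i j η, ‖(pd i)^[j] g η‖ ≤ C j * (1 + ‖η‖) ^ M j) →
      (∀ η, ‖g η‖ ≤ C 0 * (1 + ‖η‖) ^ M 0) → ∀ x : En n,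
        ‖∫ η, Complex.exp (Complex.I * (⟪x, η⟫ : ℂ)) * (g η * w η)‖ ≤
          K * (1 + ‖x‖) ^ (-(N : ℝ)) := by
  choose K hK using fun i : Fin n => exists_abs_coord_pow_mul_norm_integral_le i N w C M
  set K₀ := ∫ η, C 0 * ((1 + ‖η‖) ^ M 0 * ‖w η‖)
  refine ⟨((n : ℝ) + 1) ^ N * (K₀ + ∑ i, K i), fun g hg hb hb0 x => ?_⟩
  set J := ‖∫ η, Complex.exp (Complex.I * (⟪x, η⟫ : ℂ)) * (g η * w η)‖
  have h0 : J ≤ K₀ := by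
    refine norm_integral_le_of_norm_le ((integrable_one_add_norm_pow_mul w (M 0)).const_mul _)
      (ae_of_all _ fun η => ?_)
    rw [norm_mul, norm_exp_I_inner, one_mul, norm_mul, ← mul_assoc]
    gcongr
    exact hb0 η
  have hi : ∀ i, |x i| ^ N * J ≤ K i := fun i => hK i g hg (hb i) x
  have hJ0 : 0 ≤ J := norm_nonneg _
  have hKn : ∀ i, 0 ≤ K i := fun i => le_trans (by positivity) (hi i)
  have hmax : ∃ t : ℝ, 0 ≤ t ∧ 1 + ‖x‖ ≤ (n + 1) * t ∧ t ^ N * J ≤ K₀ + ∑ i, K i := by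
    let f : Option (Fin n) → ℝ := fun o => o.elim 1 fun i => |x i|
    obtain ⟨o, ho⟩ := Finite.exists_max f
    refine ⟨f o, zero_le_one.trans (ho none), ?_, ?_⟩
    · calc 1 + ‖x‖ ≤ 1 + ∑ i, |x i| := by gcongr; exact norm_le_sum_abs x
        _ = ∑ o, f o := by simp [f, Fintype.sum_option]
        _ ≤ ∑ _o : Option (Fin n), f o := Finset.sum_le_sum fun o' _ => ho o'
        _ = _ := by simp
    · cases o with
      | none =>
        simpa [f] using h0.trans (le_add_of_nonneg_right (Finset.sum_nonneg fun i _ => hKn i))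
      | some i =>
        exact (hi i).trans ((Finset.single_le_sum (fun i _ => hKn i) (Finset.mem_univ i)).trans
          (le_add_of_nonneg_left (hJ0.trans h0)))
  obtain ⟨t, ht0, ht, htK⟩ := hmax
  rw [Real.rpow_neg (by positivity), Real.rpow_natCast, ← div_eq_mul_inv, le_div_iff₀ (by positivity)]
  calc J * (1 + ‖x‖) ^ N ≤ J * ((n + 1) * t) ^ N := by gcongr
    _ = ((n : ℝ) + 1) ^ N * (t ^ N * J) := by rw [mul_pow]; ring
    _ ≤ _ := by gcongr

end OscillatoryIntegrals

section FourierInversion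

variable {n : ℕ}

lemma exists_schwartz_eq_ft (u : 𝓢(En n, ℂ)) :
    ∃ w : 𝓢(En n, ℂ), (∀ ξ, w ξ = ft u ξ) ∧ ∀ x : En n,
      (((2 * Real.pi) ^ (-(n : ℝ) / 2) : ℝ) : ℂ) *
        ∫ η, Complex.exp (Complex.I * (⟪x, η⟫ : ℂ)) * w η = u x := by
  have hpi : (2 * Real.pi) ≠ 0 := by positivity
  set c : ℂ := (((2 * Real.pi) ^ (-(n : ℝ) / 2) : ℝ) : ℂ) with hc
  let A : En n ≃L[ℝ] En n :=
    ContinuousLinearEquiv.smulLeft (Units.mk0 (2 * Real.pi)⁻¹ (inv_ne_zero hpi))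
  have hA : ∀ η, A η = (2 * Real.pi)⁻¹ • η := fun η => rfl
  refine ⟨c • SchwartzMap.compCLMOfContinuousLinearEquiv ℂ A (𝓕 u), fun ξ => ?_, fun x => ?_⟩
  · simp only [smul_apply, SchwartzMap.compCLMOfContinuousLinearEquiv_apply,
      Function.comp_apply, hA, SchwartzMap.fourier_coe, Real.fourier_eq', ft, smul_eq_mul]
    congr 2
    funext v
    congr 2
    rw [real_inner_smul_right]
    push_cast
    field_simp
  · have hinv : 𝓕⁻ (𝓕 (u : En n → ℂ)) x = u x := by
      rw [← SchwartzMap.fourier_coe, ← SchwartzMap.fourierInv_coe,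
        FourierTransform.fourierInv_fourier_eq]
    rw [Real.fourierInv_eq'] at hinv
    have hscale := Measure.integral_comp_inv_smul (volume : Measure (En n))
      (fun v => Complex.exp ((↑(2 * π * ⟪v, x⟫) * Complex.I)) • 𝓕 (u : En n → ℂ) v) (2 * π)
    rw [hinv] at hscale
    have hint : ∀ η : En n, Complex.exp (Complex.I * (⟪x, η⟫ : ℂ)) *
        (c • SchwartzMap.compCLMOfContinuousLinearEquiv ℂ A (𝓕 u)) η =
        c * (Complex.exp ((↑(2 * π * ⟪(2 * π)⁻¹ • η, x⟫) * Complex.I)) •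
          𝓕 (u : En n → ℂ) ((2 * π)⁻¹ • η)) := fun η => by
      simp only [smul_apply, SchwartzMap.compCLMOfContinuousLinearEquiv_apply,
        Function.comp_apply, hA, SchwartzMap.fourier_coe, smul_eq_mul]
      rw [real_inner_smul_left, mul_inv_cancel_left₀ hpi, real_inner_comm, mul_comm Complex.I]
      ring
    simp_rw [hint]
    rw [integral_const_mul, hscale, finrank_euclideanSpace_fin, abs_of_pos (by positivity),
      Complex.real_smul, ← mul_assoc, ← mul_assoc]
    have hone : c * c * (((2 * π) ^ n : ℝ) : ℂ) = 1 := by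
      rw [hc, ← Complex.ofReal_mul, ← Complex.ofReal_mul, ← Real.rpow_natCast,
        ← Real.rpow_add (by positivity), ← Real.rpow_add (by positivity)]
      ring_nf
      simp
    rw [hone, one_mul]

end FourierInversion

section SymbolEstimates

variable {n : ℕ} {Λ : En n → ℝ} {μ₀ μ₁ μ ρ m : ℝ} {σ : En n → En n → ℂ}

lemma MClass.sClass (hσ : MClass Λ ρ m σ) : SClass Λ ρ m σ := by
  have h := hσ 0 (by simp)
  have e : (fun x ξ => ((∏ i, ξ i ^ (0 : Fin n → ℕ) i : ℝ) : ℂ) * mixpd 0 0 σ x ξ) = σ := by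
    funext x ξ
    simp [mixpd, mpd_zero]
  rwa [e] at h

lemma SClass.contDiff_left (hσ : SClass Λ ρ m σ) (ξ : En n) : ContDiff ℝ ∞ fun x => σ x ξ :=
  hσ.1.comp (contDiff_id.prodMk contDiff_const)

lemma SClass.contDiff_right (hσ : SClass Λ ρ m σ) (x : En n) : ContDiff ℝ ∞ (σ x) :=
  hσ.1.comp (contDiff_const.prodMk contDiff_id)

lemma SClass.exists_norm_iterate_pd_le (hΛ : ∀ ξ, 0 < Λ ξ) (hσ : SClass Λ ρ 0 σ) :
    ∃ C : ℕ → ℝ, (∀ j, 0 ≤ C j) ∧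
      ∀ i j x ξ, ‖(pd i)^[j] (σ x) ξ‖ ≤ C j * (Λ ξ ^ (-ρ)) ^ j := by
  choose C hC hb using fun (i : Fin n) (j : ℕ) => hσ.2 0 (Pi.single i j)
  refine ⟨fun j => ∑ i, C i j, fun j => Finset.sum_nonneg fun i _ => (hC i j).le,
    fun i j x ξ => ?_⟩
  have h := hb i j x ξ
  have hs : ∑ a, (((Pi.single i j : Fin n → ℕ) a : ℕ) : ℝ) = j := by
    rw [← Nat.cast_sum]
    simp
  simp only [mixpd, mpd_zero, mpd_single] at h
  rw [hs, zero_sub, ← neg_mul, Real.rpow_mul (hΛ ξ).le, Real.rpow_natCast] at h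
  refine h.trans ?_
  have := (hΛ ξ).le
  gcongr
  exact Finset.single_le_sum (f := fun i => C i j) (fun i _ => (hC i j).le) (Finset.mem_univ i)

lemma SClass.exists_norm_fderiv_left_le (hσ : SClass Λ ρ 0 σ) :
    ∃ C : ℝ, ∀ x ξ, ‖fderiv ℝ (fun y => σ y ξ) x‖ ≤ C := by
  choose C hC hb using fun i : Fin n => hσ.2 (Pi.single i 1) 0
  refine ⟨∑ i, C i, fun x ξ => (norm_clm_le_sum_basis _).trans (Finset.sum_le_sum fun i _ => ?_)⟩
  simpa [mixpd, mpd_zero, mpd_single, pd] using hb i x ξ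

/-- After rescaling around a frequency `ξ₀` of size at least one, each frequency derivative gains
the factor `‖ξ₀‖ ^ (τ + (τ - 1) * (ρ * μ₀))`. -/
lemma IsWeight.exists_rescaled_rpow_le (hw : IsWeight n Λ μ₀ μ₁ μ) (hρ : 0 < ρ) {τ : ℝ}
    (hτ : 0 < τ) : ∃ (A : ℝ) (M : ℕ), 0 ≤ A ∧ ∀ ξ₀ η : En n, 1 ≤ ‖ξ₀‖ →
      ‖ξ₀‖ ^ τ * Λ (ξ₀ + (‖ξ₀‖ ^ τ : ℝ) • η) ^ (-ρ) ≤
        A * ‖ξ₀‖ ^ (τ + (τ - 1) * (ρ * μ₀)) * (1 + ‖η‖) ^ M := by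
  obtain ⟨C₀, C₁, hC₀, -, hg⟩ := hw.growth
  have hs : 0 < ρ * μ₀ := mul_pos hρ hw.hμ₀
  refine ⟨C₀ ^ (-ρ), ⌈ρ * μ₀⌉₊, by positivity, fun ξ₀ η hξ => ?_⟩
  have hpos : 0 < ‖ξ₀‖ := zero_lt_one.trans_le hξ
  set t := ‖ξ₀‖ ^ τ with ht
  have ht1 : 1 ≤ t := Real.one_le_rpow hξ hτ.le
  have ht0 : 0 < t := zero_lt_one.trans_le ht1
  set ζ := ξ₀ + t • η with hζ
  have hpeetre : ‖ξ₀‖ ≤ (1 + ‖ζ‖) * (t * (1 + ‖η‖)) := by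
    have h1 : ‖ξ₀‖ ≤ ‖ζ‖ + t * ‖η‖ := by
      have : ξ₀ = ζ - t • η := by simp [hζ]
      calc ‖ξ₀‖ = ‖ζ - t • η‖ := by rw [← this]
        _ ≤ _ := (norm_sub_le _ _).trans (by rw [norm_smul, Real.norm_of_nonneg ht0.le])
    have := mul_nonneg (norm_nonneg ζ) (mul_nonneg ht0.le (norm_nonneg η))
    nlinarith [norm_nonneg ζ, norm_nonneg η]
  have hinv : (1 + ‖ζ‖)⁻¹ ≤ ‖ξ₀‖ ^ (τ - 1) * (1 + ‖η‖) := by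
    rw [Real.rpow_sub_one hpos.ne', ← ht, inv_le_iff_one_le_mul₀ (by positivity), div_mul_eq_mul_div,
      div_mul_eq_mul_div, one_le_div hpos]
    linarith
  have hΛ : Λ ζ ^ (-ρ) ≤ C₀ ^ (-ρ) * (‖ξ₀‖ ^ (τ - 1) * (1 + ‖η‖)) ^ (ρ * μ₀) := by
    calc Λ ζ ^ (-ρ) ≤ (C₀ * (1 + ‖ζ‖) ^ μ₀) ^ (-ρ) :=
          Real.rpow_le_rpow_of_nonpos (by positivity) (hg ζ).1 (by linarith)
      _ = C₀ ^ (-ρ) * ((1 + ‖ζ‖)⁻¹) ^ (ρ * μ₀) := by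
        rw [Real.mul_rpow hC₀.le (by positivity), ← Real.rpow_mul (by positivity),
          Real.inv_rpow (by positivity), ← Real.rpow_neg (by positivity)]
        ring_nf
      _ ≤ _ := by gcongr
  calc t * Λ ζ ^ (-ρ) ≤ t * (C₀ ^ (-ρ) * (‖ξ₀‖ ^ (τ - 1) * (1 + ‖η‖)) ^ (ρ * μ₀)) := by gcongr
    _ = C₀ ^ (-ρ) * ‖ξ₀‖ ^ (τ + (τ - 1) * (ρ * μ₀)) * (1 + ‖η‖) ^ (ρ * μ₀) := by
      rw [Real.mul_rpow (by positivity) (by positivity), ← Real.rpow_mul hpos.le,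
        Real.rpow_add hpos, ← ht]
      ring
    _ ≤ _ := by
      gcongr
      rw [← Real.rpow_natCast]
      exact Real.rpow_le_rpow_of_exponent_le (by linarith [norm_nonneg η]) (Nat.le_ceil _)

lemma SClass.exists_norm_iterate_pd_rescaled_le (hσ : SClass Λ ρ 0 σ)
    (hw : IsWeight n Λ μ₀ μ₁ μ) (hρ : 0 < ρ) {τ : ℝ} (hτ : 0 < τ) :
    ∃ (C : ℕ → ℝ) (M : ℕ), (∀ j, 0 ≤ C j) ∧ ∀ x ξ₀ : En n, 1 ≤ ‖ξ₀‖ → ∀ i j η,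
      ‖(pd i)^[j] (fun η => σ x (ξ₀ + (‖ξ₀‖ ^ τ : ℝ) • η)) η‖ ≤
        C j * (‖ξ₀‖ ^ (τ + (τ - 1) * (ρ * μ₀))) ^ j * (1 + ‖η‖) ^ (M * j) := by
  obtain ⟨C, hC, hb⟩ := hσ.exists_norm_iterate_pd_le hw.pos
  obtain ⟨A, M, hA, hAb⟩ := hw.exists_rescaled_rpow_le hρ hτ
  refine ⟨fun j => C j * A ^ j, M, fun j => mul_nonneg (hC j) (by positivity),
    fun x ξ₀ hξ i j η => ?_⟩
  rw [iterate_pd_comp_affine, norm_smul, Real.norm_of_nonneg (by positivity)]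
  have hΛ := (hw.pos (ξ₀ + (‖ξ₀‖ ^ τ : ℝ) • η)).le
  have := hC j
  calc _ ≤ (‖ξ₀‖ ^ τ) ^ j * (C j * (Λ (ξ₀ + (‖ξ₀‖ ^ τ : ℝ) • η) ^ (-ρ)) ^ j) := by
        gcongr
        exact hb i j x _
    _ = C j * (‖ξ₀‖ ^ τ * Λ (ξ₀ + (‖ξ₀‖ ^ τ : ℝ) • η) ^ (-ρ)) ^ j := by ring
    _ ≤ C j * (A * ‖ξ₀‖ ^ (τ + (τ - 1) * (ρ * μ₀)) * (1 + ‖η‖) ^ M) ^ j :=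
        mul_le_mul_of_nonneg_left (pow_le_pow_left₀ (by positivity) (hAb ξ₀ η hξ) j) this
    _ = _ := by
        rw [mul_pow, mul_pow, pow_mul]
        ring

lemma SClass.exists_norm_rescaled_sub_le (hσ : SClass Λ ρ 0 σ)
    (hw : IsWeight n Λ μ₀ μ₁ μ) (hρ : 0 < ρ) {τ : ℝ} (hτ : 0 < τ) :
    ∃ (C C' : ℝ) (M : ℕ), ∀ x₀ ξ₀ y η : En n, 1 ≤ ‖ξ₀‖ →
      ‖σ (x₀ + (‖ξ₀‖ ^ (-τ) : ℝ) • y) (ξ₀ + (‖ξ₀‖ ^ τ : ℝ) • η) - σ x₀ ξ₀‖ ≤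
        C * ‖y‖ * ‖ξ₀‖ ^ (-τ) +
          C' * (1 + ‖η‖) ^ M * ‖η‖ * ‖ξ₀‖ ^ (τ + (τ - 1) * (ρ * μ₀)) := by
  obtain ⟨C, hC⟩ := hσ.exists_norm_fderiv_left_le
  obtain ⟨D, M, hD, hDb⟩ := hσ.exists_norm_iterate_pd_rescaled_le hw hρ hτ
  refine ⟨C, n * D 1, M, fun x₀ ξ₀ y η hξ => ?_⟩
  set t := ‖ξ₀‖ ^ τ
  set δ := ‖ξ₀‖ ^ (τ + (τ - 1) * (ρ * μ₀))
  have h1 : ‖σ (x₀ + (‖ξ₀‖ ^ (-τ) : ℝ) • y) (ξ₀ + t • η) - σ x₀ (ξ₀ + t • η)‖ ≤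
      C * ‖y‖ * ‖ξ₀‖ ^ (-τ) := by
    have h := convex_univ.norm_image_sub_le_of_norm_fderiv_le (𝕜 := ℝ)
      (f := fun y => σ y (ξ₀ + t • η))
      (fun z _ => (hσ.contDiff_left _).differentiable (by simp) z)
      (fun z _ => hC z _) (Set.mem_univ x₀) (Set.mem_univ (x₀ + (‖ξ₀‖ ^ (-τ) : ℝ) • y))
    refine h.trans_eq ?_
    rw [add_sub_cancel_left, norm_smul, Real.norm_of_nonneg (by positivity)]
    ring
  have h2 : ‖σ x₀ (ξ₀ + t • η) - σ x₀ ξ₀‖ ≤ n * D 1 * (1 + ‖η‖) ^ M * ‖η‖ * δ := by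
    have hsm : ContDiff ℝ ∞ fun η => σ x₀ (ξ₀ + t • η) :=
      (hσ.contDiff_right x₀).comp (contDiff_const.add (contDiff_id.const_smul t))
    have h := (convex_closedBall (0 : En n) ‖η‖).norm_image_sub_le_of_norm_fderiv_le (𝕜 := ℝ)
      (f := fun η => σ x₀ (ξ₀ + t • η)) (C := n * (D 1 * δ * (1 + ‖η‖) ^ M))
      (fun z _ => hsm.differentiable (by simp) z)
      (fun z hz => by
        refine (norm_clm_le_sum_basis _).trans ?_
        refine (Finset.sum_le_sum (g := fun _ => D 1 * δ * (1 + ‖η‖) ^ M) fun i _ => ?_).trans_eq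
          (by simp)
        have hz' : ‖z‖ ≤ ‖η‖ := by simpa using hz
        have := hD 1
        have hδ : 0 ≤ δ := by positivity
        refine (by simpa [pd] using hDb x₀ ξ₀ hξ i 1 z : _ ≤ D 1 * δ * (1 + ‖z‖) ^ M).trans ?_
        gcongr)
      (by simp : (0 : En n) ∈ _) (by simp : η ∈ _)
    simp only [smul_zero, add_zero, sub_zero] at h
    exact h.trans_eq (by ring)
  calc _ ≤ _ := norm_sub_le_norm_sub_add_norm_sub _ (σ x₀ (ξ₀ + t • η)) _
    _ ≤ _ := add_le_add h1 h2

end SymbolEstimates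

/-- `T_{σ_{λ_k,τ}} u → σ_∞ u` in `L^p(ℝⁿ)`. -/
theorem rescaled_pdo_tendsto (n : ℕ) (hn : 1 ≤ n) (Λ : En n → ℝ) (μ₀ μ₁ μ ρ : ℝ)
    (hw : IsWeight n Λ μ₀ μ₁ μ) (hρ : 0 < ρ) (hρμ : ρ ≤ 1 / μ)
    (σ : En n → En n → ℂ) (hσ : MClass Λ ρ 0 σ)
    (p : ℝ) (hp : 1 < p)
    (τ : ℝ) (hτ0 : 0 < τ) (hτ1 : τ < ρ * μ₀ / (1 + ρ * μ₀))
    (xk ξk : ℕ → En n) (hξk : Tendsto (fun k => ‖ξk k‖) atTop atTop)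
    (σinf : ℂ) (hσinf : Tendsto (fun k => σ (xk k) (ξk k)) atTop (nhds σinf))
    (u : SchwartzMap (En n) ℂ) :
    Tendsto (fun k =>
        eLpNorm (fun x : En n =>
          pdo (fun y η => σ (xk k + ((‖ξk k‖ : ℝ) ^ (-τ) : ℝ) • y)
                            (ξk k + ((‖ξk k‖ : ℝ) ^ τ : ℝ) • η)) (⇑u) x
            - σinf * u x) (ENNReal.ofReal p) volume)
      atTop (nhds 0) := by
  have hS := hσ.sClass
  obtain ⟨w, hwft, hinv⟩ := exists_schwartz_eq_ft u
  set c : ℂ := (((2 * Real.pi) ^ (-(n : ℝ) / 2) : ℝ) : ℂ)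
  set d : ℝ := τ + (τ - 1) * (ρ * μ₀)
  have hs : 0 < ρ * μ₀ := mul_pos hρ hw.hμ₀
  have hd : d < 0 := by
    rw [lt_div_iff₀ (by linarith)] at hτ1
    simp only [d]
    linarith
  set a : ℕ → En n → En n → ℂ := fun k y η =>
    σ (xk k + ((‖ξk k‖ : ℝ) ^ (-τ) : ℝ) • y) (ξk k + ((‖ξk k‖ : ℝ) ^ τ : ℝ) • η) with ha
  have hlarge : ∀ᶠ k in atTop, 1 ≤ ‖ξk k‖ := hξk.eventually_ge_atTop 1
  have ha_cont : ∀ k, Continuous fun q : En n × En n => a k q.1 q.2 := fun k =>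
    hS.1.continuous.comp (g := fun q : En n × En n => σ q.1 q.2)
      (f := fun q : En n × En n => (xk k + ((‖ξk k‖ : ℝ) ^ (-τ) : ℝ) • q.1,
        ξk k + ((‖ξk k‖ : ℝ) ^ τ : ℝ) • q.2)) (by fun_prop)
  have ha_smooth : ∀ k y, ContDiff ℝ ∞ (a k y) := fun k y =>
    (hS.contDiff_right _).comp (contDiff_const.add (contDiff_id.const_smul _))
  obtain ⟨C, -, hC⟩ := hS.exists_norm_iterate_pd_le hw.pos
  obtain ⟨i₀⟩ : Nonempty (Fin n) := ⟨⟨0, hn⟩⟩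
  have ha_bdd : ∀ k y η, ‖a k y η‖ ≤ C 0 := fun k y η => by
    simpa using hC i₀ 0 (xk k + ((‖ξk k‖ : ℝ) ^ (-τ) : ℝ) • y) (ξk k + ((‖ξk k‖ : ℝ) ^ τ : ℝ) • η)
  -- pointwise convergence of the rescaled symbols
  have ha_lim : ∀ y η, Tendsto (fun k => a k y η) atTop (nhds σinf) := fun y η => by
    obtain ⟨B, B', M, hB⟩ := hS.exists_norm_rescaled_sub_le hw hρ hτ0
    have hz : Tendsto (fun k => a k y η - σ (xk k) (ξk k)) atTop (nhds 0) := by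
      refine squeeze_zero_norm' (hlarge.mono fun k hk => hB (xk k) (ξk k) y η hk) ?_
      have e1 : Tendsto (fun k => ‖ξk k‖ ^ (-τ)) atTop (nhds 0) :=
        (tendsto_rpow_neg_atTop hτ0).comp hξk
      have e2 : Tendsto (fun k => ‖ξk k‖ ^ d) atTop (nhds 0) := by
        simpa [Function.comp_def] using (tendsto_rpow_neg_atTop (neg_pos.2 hd)).comp hξk
      simpa using (e1.const_mul (B * ‖y‖)).add (e2.const_mul (B' * (1 + ‖η‖) ^ M * ‖η‖))
    simpa using hz.add hσinf
  have hpdo : ∀ k x, pdo (a k) u x =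
      c * ∫ η, Complex.exp (Complex.I * (⟪x, η⟫ : ℂ)) * (a k x η * w η) := fun k x => by
    simp only [pdo, ← hwft, mul_assoc]
    rfl
  have hmeas : ∀ k, AEStronglyMeasurable (fun x => pdo (a k) u x - σinf * u x) volume := by
    intro k
    have hJ : StronglyMeasurable fun x : En n =>
        ∫ η, Complex.exp (Complex.I * (⟪x, η⟫ : ℂ)) * (a k x η * w η) := by
      refine StronglyMeasurable.integral_prod_right (f := fun x η : En n =>
        Complex.exp (Complex.I * (⟪x, η⟫ : ℂ)) * (a k x η * w η)) ?_
      have h1 := ha_cont k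
      have h2 := w.continuous
      refine Continuous.stronglyMeasurable ?_
      simp only [Function.uncurry_def]
      fun_prop
    simp_rw [hpdo]
    exact ((hJ.const_mul c).sub (u.continuous.stronglyMeasurable.const_mul σinf)).aestronglyMeasurable
  -- pointwise convergence of the functions
  have hlim : ∀ x, Tendsto (fun k => pdo (a k) u x - σinf * u x) atTop (nhds 0) := fun x => by
    have h : Tendsto (fun k => ∫ η, Complex.exp (Complex.I * (⟪x, η⟫ : ℂ)) * (a k x η * w η))
        atTop (nhds (∫ η, Complex.exp (Complex.I * (⟪x, η⟫ : ℂ)) * (σinf * w η))) := by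
      refine tendsto_integral_of_dominated_convergence (fun η => C 0 * ‖w η‖)
        (fun k => ((differentiable_exp_I_inner x).continuous.mul
          ((ha_smooth k x).continuous.mul w.continuous)).aestronglyMeasurable)
        (w.integrable.norm.const_mul _) (fun k => ae_of_all _ fun η => ?_)
        (ae_of_all _ fun η => ((ha_lim x η).mul_const _).const_mul _)
      rw [norm_mul, norm_exp_I_inner, one_mul, norm_mul]
      gcongr
      exact ha_bdd k x η
    have e : c * ∫ η, Complex.exp (Complex.I * (⟪x, η⟫ : ℂ)) * (σinf * w η) = σinf * u x := by
      simp_rw [mul_left_comm _ σinf]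
      rw [integral_const_mul, mul_left_comm, hinv]
    have hsub := (h.const_mul c).sub_const (σinf * u x)
    rw [e, sub_self] at hsub
    simpa only [hpdo] using hsub
  -- uniform decay
  obtain ⟨K, hK⟩ : ∃ K : ℝ, ∀ᶠ k in atTop, ∀ x,
      ‖pdo (a k) u x - σinf * u x‖ ≤ K * (1 + ‖x‖) ^ (-((n + 1 : ℕ) : ℝ)) := by
    obtain ⟨D, M, hD, hDb⟩ := hS.exists_norm_iterate_pd_rescaled_le hw hρ hτ0
    obtain ⟨K₁, hK₁⟩ := exists_norm_integral_le_one_add_norm (n + 1) w D (fun j => M * j)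
    obtain ⟨K₂, hK₂⟩ : ∃ K₂ : ℝ, ∀ x, ‖u x‖ ≤ K₂ * (1 + ‖x‖) ^ (-((n + 1 : ℕ) : ℝ)) := by
      refine ⟨2 ^ (n + 1) * ((Finset.Iic (n + 1, 0)).sup fun m =>
        SchwartzMap.seminorm ℝ m.1 m.2) u, fun x => ?_⟩
      have h := SchwartzMap.one_add_le_sup_seminorm_apply (𝕜 := ℝ) (m := (n + 1, 0)) le_rfl le_rfl
        u x
      rw [norm_iteratedFDeriv_zero, mul_comm] at h
      rw [Real.rpow_neg (by positivity), Real.rpow_natCast, ← div_eq_mul_inv,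
        le_div_iff₀ (by positivity)]
      exact h
    refine ⟨‖c‖ * K₁ + ‖σinf‖ * K₂, hlarge.mono fun k hk x => ?_⟩
    have hb : ∀ i j η, ‖(pd i)^[j] (a k x) η‖ ≤ D j * (1 + ‖η‖) ^ (M * j) := fun i j η => by
      refine (hDb _ (ξk k) hk i j η).trans ?_
      have hle : ‖ξk k‖ ^ d ≤ 1 := Real.rpow_le_one_of_one_le_of_nonpos hk hd.le
      have := hD j
      gcongr
      exact mul_le_of_le_one_right this (pow_le_one₀ (by positivity) hle)
    refine (norm_sub_le _ _).trans ?_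
    rw [hpdo, norm_mul, norm_mul, add_mul, mul_assoc, mul_assoc]
    gcongr
    · exact hK₁ (a k x) (ha_smooth k x) hb (hb i₀ 0) x
    · exact hK₂ x
  -- dominated convergence
  have hp0 : 0 < p := zero_lt_one.trans hp
  have hpne : ENNReal.ofReal p ≠ 0 := by simpa using hp0
  simp_rw [eLpNorm_eq_lintegral_rpow_enorm_toReal hpne ENNReal.ofReal_ne_top,
    ENNReal.toReal_ofReal hp0.le]
  have hint : Integrable (fun x : En n => K ^ p * (1 + ‖x‖) ^ (-(((n + 1 : ℕ) : ℝ) * p))) := by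
    refine (integrable_one_add_norm ?_).const_mul _
    rw [finrank_euclideanSpace_fin]
    push_cast
    nlinarith
  have hL : Tendsto (fun k => ∫⁻ x, ‖pdo (a k) u x - σinf * u x‖ₑ ^ p) atTop (nhds 0) := by
    have hmain := tendsto_lintegral_filter_of_dominated_convergence' (μ := volume) (l := atTop)
      (F := fun k x => ‖pdo (a k) u x - σinf * u x‖ₑ ^ p) (f := fun _ => 0) _
      (Eventually.of_forall fun k => (hmeas k).enorm.pow_const p)
      (hK.mono fun k hk => ae_of_all _ fun x => ?_) hint.lintegral_lt_top.ne
      (ae_of_all _ fun x => ?_)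
    · simpa using hmain
    · have hK0 : 0 ≤ K := by simpa using (norm_nonneg _).trans (hk 0)
      rw [← ofReal_norm, ENNReal.ofReal_rpow_of_nonneg (norm_nonneg _) hp0.le]
      refine ENNReal.ofReal_le_ofReal ((Real.rpow_le_rpow (norm_nonneg _) (hk x) hp0.le).trans_eq ?_)
      rw [Real.mul_rpow hK0 (by positivity), ← Real.rpow_mul (by positivity), neg_mul]
    · have h := (ENNReal.continuous_rpow_const (y := p)).tendsto 0 |>.comp
        (by simpa using (hlim x).enorm)
      simpa [Function.comp_def, ENNReal.zero_rpow_of_pos hp0] using h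
  have := (ENNReal.continuous_rpow_const (y := 1 / p)).tendsto 0 |>.comp hL
  simpa [Function.comp_def, ha, ENNReal.zero_rpow_of_pos (inv_pos.2 hp0)] using this
end

section
/- Let σ ∈ S^0_{ρ,Λ} and let F : ℂ → ℂ be a C^∞ function (smooth as a function of two real variables). Then F ∘ σ ∈ S^0_{ρ,Λ}; that is, for all multi-indices α and β there exists a constant C_{α,β} > 0 such that |(∂_x^α ∂_ξ^β (F ∘ σ))(x,ξ)| ≤ C_{α,β} Λ(ξ)^{−ρ|β|} for all x, ξ ∈ ℝⁿ. -/
open MeasureTheory Real Filter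
open scoped RealInnerProductSpace BigOperators ENNReal

open scoped ContDiff

universe u

section DirectionalDerivatives

variable {Q E G ι : Type*} [NormedAddCommGroup Q] [NormedSpace ℝ Q]
  [NormedAddCommGroup E] [NormedSpace ℝ E] [NormedAddCommGroup G] [NormedSpace ℝ G]

/-- The derivative of `g` in the direction `v`. -/
noncomputable def dirDeriv (v : Q) (g : Q → E) : Q → E := fun q => fderiv ℝ g q v

/-- The iterated directional derivative in which the direction `v i` is used `γ i` times for every
entry `i` of the list `l`. -/
noncomputable def multiDirDeriv (v : ι → Q) (γ : ι → ℕ) (l : List ι) (g : Q → E) : Q → E :=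
  l.foldr (fun i h => (dirDeriv (v i))^[γ i] h) g

theorem ContDiff.dirDeriv {g : Q → E} (hg : ContDiff ℝ ∞ g) (v : Q) :
    ContDiff ℝ ∞ (dirDeriv v g) :=
  (hg.fderiv_right (m := ∞) (by simp)).clm_apply contDiff_const

theorem ContDiff.iterate_dirDeriv {g : Q → E} (hg : ContDiff ℝ ∞ g) (v : Q) (k : ℕ) :
    ContDiff ℝ ∞ ((_root_.dirDeriv v)^[k] g) := by
  induction k generalizing g with
  | zero => exact hg
  | succ k ih => exact ih (hg.dirDeriv v)

theorem ContDiff.multiDirDeriv {g : Q → E} (hg : ContDiff ℝ ∞ g) (v : ι → Q) (γ : ι → ℕ)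
    (l : List ι) : ContDiff ℝ ∞ (multiDirDeriv v γ l g) := by
  induction l with
  | nil => exact hg
  | cons i l ih => exact ih.iterate_dirDeriv (v i) (γ i)

theorem dirDeriv_comm {g : Q → E} (hg : ContDiff ℝ ∞ g) (u v : Q) :
    dirDeriv u (dirDeriv v g) = dirDeriv v (dirDeriv u g) := by
  have hd : Differentiable ℝ (fderiv ℝ g) :=
    (hg.fderiv_right (m := ∞) (by simp)).differentiable (by simp)
  have key (a b : Q) (q : Q) :
      dirDeriv a (dirDeriv b g) q = fderiv ℝ (fderiv ℝ g) q a b := by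
    have h := (hd q).hasFDerivAt.clm_apply (hasFDerivAt_const b q)
    have h' : fderiv ℝ (dirDeriv b g) q = _ := h.fderiv
    simp [dirDeriv.eq_1 a, h']
  funext q
  rw [key, key]
  exact hg.contDiffAt.isSymmSndFDerivAt
    (by simpa using WithTop.coe_le_coe.2 (le_top : (2 : ℕ∞) ≤ ⊤)) u v

theorem dirDeriv_iterate_comm {g : Q → E} (hg : ContDiff ℝ ∞ g) (u v : Q) (k : ℕ) :
    dirDeriv u ((dirDeriv v)^[k] g) = (dirDeriv v)^[k] (dirDeriv u g) := by
  induction k generalizing g with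
  | zero => rfl
  | succ k ih =>
    rw [Function.iterate_succ_apply, Function.iterate_succ_apply, ih (hg.dirDeriv v),
      dirDeriv_comm hg]

theorem multiDirDeriv_congr (v : ι → Q) {γ δ : ι → ℕ} {l : List ι} (h : ∀ i ∈ l, γ i = δ i)
    (g : Q → E) : multiDirDeriv v γ l g = multiDirDeriv v δ l g := by
  induction l with
  | nil => rfl
  | cons i l ih =>
    simp only [multiDirDeriv, List.foldr_cons] at ih ⊢
    rw [ih fun j hj => h j (List.mem_cons_of_mem i hj), h i List.mem_cons_self]

theorem dirDeriv_multiDirDeriv [DecidableEq ι] (v : ι → Q) (γ : ι → ℕ) {l : List ι}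
    (hl : l.Nodup) {i : ι} (hi : i ∈ l) {g : Q → E} (hg : ContDiff ℝ ∞ g) :
    dirDeriv (v i) (multiDirDeriv v γ l g) = multiDirDeriv v (γ + Pi.single i 1) l g := by
  induction l with
  | nil => simp at hi
  | cons j l ih =>
    obtain ⟨hjl, hl⟩ := List.nodup_cons.1 hl
    change dirDeriv (v i) ((dirDeriv (v j))^[γ j] (multiDirDeriv v γ l g)) =
      (dirDeriv (v j))^[(γ + Pi.single i 1 : ι → ℕ) j] (multiDirDeriv v (γ + Pi.single i 1) l g)
    by_cases hij : j = i
    · subst hij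
      have hcongr : multiDirDeriv v (γ + Pi.single j 1) l g = multiDirDeriv v γ l g :=
        multiDirDeriv_congr v (fun k hk => by
          simp [show k ≠ j from fun h => hjl (h ▸ hk)]) g
      rw [hcongr, ← Function.iterate_succ_apply' (dirDeriv (v j))]
      simp
    · have hil : i ∈ l := (List.mem_cons.1 hi).resolve_left (Ne.symm hij)
      rw [dirDeriv_iterate_comm (hg.multiDirDeriv v γ l), ih hl hil]
      simp [hij]

/-- `g` and its directional derivatives up to order `N` along the directions `v i` are bounded by
powers of the weight `w`; the exponent starts at `k` and increases by `o i` with each derivative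
along `v i`. -/
def DerivBound (w : Q → ℝ) (v : ι → Q) (o : ι → ℕ) : ℕ → ℕ → (Q → E) → Prop
  | 0, k, g => ∃ C, ∀ q, ‖g q‖ ≤ C * w q ^ k
  | N + 1, k, g => (∃ C, ∀ q, ‖g q‖ ≤ C * w q ^ k) ∧
      ∀ i, DerivBound w v o N (k + o i) (dirDeriv (v i) g)

variable {w : Q → ℝ} {v : ι → Q} {o : ι → ℕ}

theorem DerivBound.bound {N k : ℕ} {g : Q → E} (h : DerivBound w v o N k g) :
    ∃ C, ∀ q, ‖g q‖ ≤ C * w q ^ k := by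
  cases N with
  | zero => exact h
  | succ N => exact h.1

theorem DerivBound.of_succ {N k : ℕ} {g : Q → E} (h : DerivBound w v o (N + 1) k g) :
    DerivBound w v o N k g := by
  induction N generalizing k g with
  | zero => exact h.1
  | succ N ih => exact ⟨h.1, fun i => ih (h.2 i)⟩

theorem DerivBound.add {N k : ℕ} {f g : Q → E} (hf : ContDiff ℝ ∞ f) (hg : ContDiff ℝ ∞ g)
    (hbf : DerivBound w v o N k f) (hbg : DerivBound w v o N k g) :
    DerivBound w v o N k (fun q => f q + g q) := by
  induction N generalizing k f g with
  | zero =>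
    obtain ⟨C, hC⟩ := hbf.bound
    obtain ⟨D, hD⟩ := hbg.bound
    refine ⟨C + D, fun q => (norm_add_le _ _).trans ?_⟩
    rw [add_mul]
    exact add_le_add (hC q) (hD q)
  | succ N ih =>
    refine ⟨(ih hf hg hbf.of_succ hbg.of_succ).bound, fun i => ?_⟩
    have hadd : dirDeriv (v i) (fun q => f q + g q) =
        fun q => dirDeriv (v i) f q + dirDeriv (v i) g q := by
      funext q
      simp [dirDeriv, fderiv_fun_add (hf.differentiable (by simp) q)
        (hg.differentiable (by simp) q)]
    rw [hadd]
    exact ih (hf.dirDeriv _) (hg.dirDeriv _) (hbf.2 i) (hbg.2 i)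

theorem dirDeriv_clm_apply {a : Q → G →L[ℝ] E} {b : Q → G} (ha : ContDiff ℝ ∞ a)
    (hb : ContDiff ℝ ∞ b) (u : Q) :
    dirDeriv u (fun q => a q (b q)) =
      fun q => a q (dirDeriv u b q) + dirDeriv u a q (b q) := by
  funext q
  have h := ((ha.differentiable (by simp) q).hasFDerivAt.clm_apply
    (hb.differentiable (by simp) q).hasFDerivAt).fderiv
  simp [dirDeriv, h]

theorem DerivBound.clm_apply {N k m : ℕ} {a : Q → G →L[ℝ] E} {b : Q → G}
    (ha : ContDiff ℝ ∞ a) (hb : ContDiff ℝ ∞ b)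
    (hba : DerivBound w v o N k a) (hbb : DerivBound w v o N m b) :
    DerivBound w v o N (k + m) (fun q => a q (b q)) := by
  induction N generalizing k m a b with
  | zero =>
    obtain ⟨C, hC⟩ := hba.bound
    obtain ⟨D, hD⟩ := hbb.bound
    refine ⟨C * D, fun q => ((a q).le_opNorm _).trans ?_⟩
    calc ‖a q‖ * ‖b q‖ ≤ (C * w q ^ k) * (D * w q ^ m) :=
          mul_le_mul (hC q) (hD q) (norm_nonneg _) ((norm_nonneg _).trans (hC q))
      _ = C * D * w q ^ (k + m) := by ring
  | succ N ih =>
    refine ⟨(ih ha hb hba.of_succ hbb.of_succ).bound, fun i => ?_⟩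
    rw [dirDeriv_clm_apply ha hb]
    refine DerivBound.add (ha.clm_apply (hb.dirDeriv _)) ((ha.dirDeriv _).clm_apply hb) ?_ ?_
    · rw [add_assoc]
      exact ih ha (hb.dirDeriv _) hba.of_succ (hbb.2 i)
    · rw [add_right_comm]
      exact ih (ha.dirDeriv _) hb (hba.2 i) hbb.of_succ

theorem dirDeriv_comp {s : Q → G} (hs : ContDiff ℝ ∞ s) {F : G → E} (hF : ContDiff ℝ ∞ F)
    (u : Q) : dirDeriv u (fun q => F (s q)) = fun q => fderiv ℝ F (s q) (dirDeriv u s q) := by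
  funext q
  have h := ((hF.differentiable (by simp) (s q)).hasFDerivAt.comp q
    (hs.differentiable (by simp) q).hasFDerivAt).fderiv
  simp only [dirDeriv]
  exact congrArg (fun L : Q →L[ℝ] E => L u) h

theorem DerivBound.comp {G E : Type u} [NormedAddCommGroup G] [NormedSpace ℝ G] [ProperSpace G]
    [NormedAddCommGroup E] [NormedSpace ℝ E] {N : ℕ} {s : Q → G} (hs : ContDiff ℝ ∞ s)
    (hbs : DerivBound w v o N 0 s) {F : G → E} (hF : ContDiff ℝ ∞ F) :
    DerivBound w v o N 0 (fun q => F (s q)) := by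
  induction N generalizing E with
  | zero =>
    obtain ⟨C, hC⟩ := hbs.bound
    obtain ⟨D, hD⟩ := (isCompact_closedBall (0 : G) C).exists_bound_of_continuousOn
      hF.continuous.continuousOn
    exact ⟨D, fun q => by simpa using hD (s q) (by simpa using hC q)⟩
  | succ N ih =>
    refine ⟨(ih hbs.of_succ hF).bound, fun i => ?_⟩
    rw [dirDeriv_comp hs hF]
    have hF' : ContDiff ℝ ∞ (fderiv ℝ F) := hF.fderiv_right (by simp)
    exact DerivBound.clm_apply (hF'.comp hs) (hs.dirDeriv _) (ih hbs.of_succ hF') (by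
      simpa using hbs.2 i)

theorem derivBound_multiDirDeriv {k : ℕ} {g : Q → E} (h : ∀ N, DerivBound w v o N k g)
    (γ : ι → ℕ) (l : List ι) (N : ℕ) :
    DerivBound w v o N (k + (l.map fun i => γ i * o i).sum) (multiDirDeriv v γ l g) := by
  have iter (i : ι) (j : ℕ) : ∀ {k : ℕ} {g : Q → E}, (∀ N, DerivBound w v o N k g) →
      ∀ N, DerivBound w v o N (k + j * o i) ((dirDeriv (v i))^[j] g) := by
    induction j with
    | zero => simp
    | succ j ih =>
      intro k g h N
      have h' := ih (fun M => (h (M + 1)).2 i) N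
      rwa [show k + o i + j * o i = k + (j + 1) * o i by ring] at h'
  induction l generalizing N with
  | nil => simpa [multiDirDeriv] using h N
  | cons i l ih =>
    have h' := iter i (γ i) ih N
    rw [List.map_cons, List.sum_cons, add_comm (γ i * o i), ← add_assoc]
    exact h'

theorem derivBound_of_multiDirDeriv [Fintype ι] [DecidableEq ι] {l : List ι} (hl : l.Nodup)
    (hmem : ∀ i, i ∈ l) {g : Q → E} (hg : ContDiff ℝ ∞ g)
    (h : ∀ γ : ι → ℕ, ∃ C, ∀ q, ‖multiDirDeriv v γ l g q‖ ≤ C * w q ^ ∑ i, γ i * o i)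
    (N : ℕ) (γ : ι → ℕ) :
    DerivBound w v o N (∑ i, γ i * o i) (multiDirDeriv v γ l g) := by
  induction N generalizing γ with
  | zero => exact h γ
  | succ N ih =>
    refine ⟨h γ, fun i => ?_⟩
    rw [dirDeriv_multiDirDeriv v γ hl (hmem i) hg]
    have h' := ih (γ + Pi.single i 1)
    simpa [add_mul, Finset.sum_add_distrib, Pi.single_apply] using h'

theorem mpd_comp {n : ℕ} {j : En n → Q} {L : En n →L[ℝ] Q} (hj : ∀ y, HasFDerivAt j L y)
    {v : Fin n → Q} (hv : ∀ i, L (EuclideanSpace.single i 1) = v i) (α : Fin n → ℕ)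
    {g : Q → E} (hg : ContDiff ℝ ∞ g) :
    mpd α (fun y => g (j y)) = fun y => multiDirDeriv v α (List.finRange n) g (j y) := by
  have single (i : Fin n) {g : Q → E} (hg : ContDiff ℝ ∞ g) :
      pd i (fun y => g (j y)) = fun y => dirDeriv (v i) g (j y) := by
    funext y
    have h := ((hg.differentiable (by simp) (j y)).hasFDerivAt.comp y (hj y)).fderiv
    simp only [pd, dirDeriv, ← hv i]
    exact congrArg (fun T : En n →L[ℝ] E => T (EuclideanSpace.single i 1)) h
  have iter (i : Fin n) (k : ℕ) : ∀ {g : Q → E}, ContDiff ℝ ∞ g →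
      (pd i)^[k] (fun y => g (j y)) = fun y => (dirDeriv (v i))^[k] g (j y) := by
    induction k with
    | zero => intro g _; rfl
    | succ k ih =>
      intro g hg
      rw [Function.iterate_succ_apply, single i hg, ih (hg.dirDeriv _)]
      rfl
  unfold mpd
  induction List.finRange n with
  | nil => rfl
  | cons i l ih =>
    rw [List.foldr_cons, ih, iter i (α i) (hg.multiDirDeriv v α l)]
    rfl

end DirectionalDerivatives

section Symbols

variable {n : ℕ}

/-- The coordinate directions of `ℝⁿ × ℝⁿ`. -/
noncomputable def coordDir (n : ℕ) : Fin n ⊕ Fin n → En n × En n :=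
  Sum.elim (fun i => (EuclideanSpace.single i 1, 0)) (fun i => (0, EuclideanSpace.single i 1))

/-- The list of all coordinates of `ℝⁿ × ℝⁿ`. -/
def coordList (n : ℕ) : List (Fin n ⊕ Fin n) :=
  (List.finRange n).map Sum.inl ++ (List.finRange n).map Sum.inr

/-- The order in `ξ` of the derivative along a coordinate. -/
def ξOrder (n : ℕ) : Fin n ⊕ Fin n → ℕ := Sum.elim 0 1

theorem nodup_coordList : (coordList n).Nodup := by
  refine List.Nodup.append ((List.nodup_finRange n).map Sum.inl_injective)
    ((List.nodup_finRange n).map Sum.inr_injective) ?_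
  simp [List.disjoint_left]

theorem mem_coordList (i : Fin n ⊕ Fin n) : i ∈ coordList n := by
  cases i <;> simp [coordList]

theorem sum_elim_mul_ξOrder (α β : Fin n → ℕ) :
    ∑ i, Sum.elim α β i * ξOrder n i = ∑ i, β i := by
  simp [ξOrder]

theorem sum_map_coordList (f : Fin n ⊕ Fin n → ℕ) : ((coordList n).map f).sum = ∑ i, f i := by
  simp [coordList, Fin.sum_univ_def, Function.comp_def]

theorem mixpd_eq_multiDirDeriv {σ : En n → En n → ℂ}
    (hσ : ContDiff ℝ ∞ fun q : En n × En n => σ q.1 q.2) (α β : Fin n → ℕ) (x ξ : En n) :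
    mixpd α β σ x ξ = multiDirDeriv (coordDir n) (Sum.elim α β) (coordList n)
      (fun q : En n × En n => σ q.1 q.2) (x, ξ) := by
  have hξ (y : En n) := mpd_comp (fun η : En n => hasFDerivAt_prodMk_right y η)
    (v := fun i => coordDir n (Sum.inr i)) (fun i => by simp [coordDir]) β hσ
  have hx := mpd_comp (fun y : En n => hasFDerivAt_prodMk_left y ξ)
    (v := fun i => coordDir n (Sum.inl i)) (fun i => by simp [coordDir]) α
    (hσ.multiDirDeriv (fun i => coordDir n (Sum.inr i)) β (List.finRange n))
  simp only at hξ
  simp only [mixpd, hξ, hx]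
  simp [multiDirDeriv, coordList, List.foldr_map]

theorem rpow_zero_sub_mul_sum {a : ℝ} (ha : 0 < a) (ρ : ℝ) (β : Fin n → ℕ) :
    a ^ (0 - ρ * ∑ i, (β i : ℝ)) = (a ^ (-ρ)) ^ ∑ i, β i := by
  rw [← Real.rpow_mul_natCast ha.le]
  congr 1
  push_cast
  ring

theorem sClass_zero_iff {Λ : En n → ℝ} (hΛ : ∀ ξ, 0 < Λ ξ) {ρ : ℝ} {σ : En n → En n → ℂ} :
    SClass Λ ρ 0 σ ↔ ContDiff ℝ ∞ (fun q : En n × En n => σ q.1 q.2) ∧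
      ∀ N, DerivBound (fun q : En n × En n => Λ q.2 ^ (-ρ)) (coordDir n) (ξOrder n) N 0
        (fun q : En n × En n => σ q.1 q.2) := by
  refine and_congr_right fun hσ => ⟨fun h N => ?_, fun h α β => ?_⟩
  · have h' := derivBound_of_multiDirDeriv (w := fun q : En n × En n => Λ q.2 ^ (-ρ))
      (v := coordDir n) (o := ξOrder n) nodup_coordList mem_coordList hσ (fun γ => ?_) N 0
    · have h0 : multiDirDeriv (coordDir n) 0 (coordList n)
          (fun q : En n × En n => σ q.1 q.2) = fun q => σ q.1 q.2 := by
        simp [multiDirDeriv]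
      simpa [h0] using h'
    · obtain ⟨α, β, rfl⟩ : ∃ α β, γ = Sum.elim α β :=
        ⟨_, _, (Sum.elim_comp_inl_inr γ).symm⟩
      obtain ⟨C, -, hC⟩ := h α β
      refine ⟨C, fun q => ?_⟩
      rw [sum_elim_mul_ξOrder, ← rpow_zero_sub_mul_sum (hΛ q.2)]
      simpa only [mixpd_eq_multiDirDeriv hσ] using hC q.1 q.2
  · obtain ⟨C, hC⟩ := (derivBound_multiDirDeriv h (Sum.elim α β) (coordList n) 0).bound
    refine ⟨max C 1, by positivity, fun x ξ => ?_⟩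
    rw [mixpd_eq_multiDirDeriv hσ, rpow_zero_sub_mul_sum (hΛ ξ)]
    refine (hC (x, ξ)).trans ?_
    rw [sum_map_coordList, sum_elim_mul_ξOrder, zero_add]
    have := (Real.rpow_pos_of_pos (hΛ ξ) (-ρ)).le
    gcongr
    exact le_max_left _ _

end Symbols

/-- if `σ ∈ S^0_{ρ,Λ}` and `F : ℂ → ℂ` is smooth, then `F ∘ σ ∈ S^0_{ρ,Λ}`. -/
theorem comp_SClass_zero (n : ℕ) (hn : 1 ≤ n) (Λ : En n → ℝ) (μ₀ μ₁ μ ρ : ℝ)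
    (hw : IsWeight n Λ μ₀ μ₁ μ) (hρ : 0 < ρ) (hρμ : ρ ≤ 1 / μ)
    (σ : En n → En n → ℂ) (hσ : SClass Λ ρ 0 σ)
    (F : ℂ → ℂ) (hF : ContDiff ℝ (⊤ : ℕ∞) F) :
    SClass Λ ρ 0 (fun x ξ => F (σ x ξ)) := by
  obtain ⟨hs, hb⟩ := (sClass_zero_iff hw.pos).1 hσ
  exact (sClass_zero_iff hw.pos).2 ⟨hF.comp hs, fun N => (hb N).comp hs hF⟩
end
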